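/- Given v ∈ C_b(Ω,ℝ^d), define f ∈ C_b(Ω) by f(ω) := π_ω(0)^{-1} (∇*(c v))(ω). Then for every finite Λ ⊆ Z^d and every ω ∈ Ω, ⟨f∘τ(ω), (−𝖫_ω)^{-1}_Λ f∘τ(ω)⟩_{ℓ²(Λ,π_ω)} = ⟨v∘τ(ω), v∘τ(ω)⟩_{ℓ²(E(Λ),c_ω)} − inf_{h∈ℓ²(Λ,π_ω)} ⟨v∘τ(ω) − ∇h, v∘τ(ω) − ∇h⟩_{ℓ²(E(Λ),c_ω)}. -/

import Mathlib

open MeasureTheory Filter Topology Matrix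
open scoped ENNReal NNReal

noncomputable section

namespace DetCond

/-- Vertices of `ℤ^d`. -/
abbrev Vert (d : ℕ) := Fin d → ℤ

/-- Index of the (unordered) nearest-neighbour edge `(x, x + e i)` of `ℤ^d`;
the set of these indices is in natural bijection with `E(ℤ^d)` modulo orientation. -/
abbrev EdgeIx (d : ℕ) := Vert d × Fin d

/-- The space `Ω = (0,∞)^{E(ℤ^d)}` of (symmetric) conductance configurations, with
its product topology and product σ-algebra. -/
abbrev EnvSp (d : ℕ) := {ω : EdgeIx d → ℝ // ∀ e, 0 < ω e}

/-- The `i`-th coordinate unit vector of `ℤ^d`. -/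
def unitv (d : ℕ) (i : Fin d) : Vert d := fun j => if j = i then 1 else 0

/-- The translation `τ_x` acting on environments: `c_{τ_x ω}(y,z) = c_ω(y+x,z+x)`. -/
def shift (d : ℕ) (x : Vert d) (ω : EnvSp d) : EnvSp d :=
  ⟨fun e => ω.1 (e.1 + x, e.2), fun e => ω.2 (e.1 + x, e.2)⟩

/-- The conductance `c_ω(x,y)`; it vanishes when `x,y` are not nearest neighbours
and is symmetric in `x,y` by construction. -/
def cnd (d : ℕ) (ω : EnvSp d) (x y : Vert d) : ℝ :=
  ∑ i, ((if y = x + unitv d i then ω.1 (x, i) else 0) +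
        (if x = y + unitv d i then ω.1 (y, i) else 0))

/-- `π_ω(x) = Σ_{z : (x,z) ∈ E(ℤ^d)} c_ω(x,z)`. -/
def piOf (d : ℕ) (ω : EnvSp d) (x : Vert d) : ℝ :=
  ∑ i, (ω.1 (x, i) + ω.1 (x - unitv d i, i))

/-- The box `Λ_r = [-r,r]^d ∩ ℤ^d`. -/
def box (d : ℕ) (r : ℝ) : Finset (Vert d) :=
  Fintype.piFinset fun _ : Fin d => Finset.Icc ⌈-r⌉ ⌊r⌋

/-- The nearest neighbours of `x` in `ℤ^d`. -/
def nbrs (d : ℕ) (x : Vert d) : Finset (Vert d) :=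
  (Finset.univ.image fun i => x + unitv d i) ∪ (Finset.univ.image fun i => x - unitv d i)

/-- The set `E(Λ)` of edges incident with at least one vertex of `Λ`
(one index per unordered edge). -/
def edgesIn (d : ℕ) (Λ : Finset (Vert d)) : Finset (EdgeIx d) :=
  Λ.biUnion fun x =>
    (Finset.univ.image fun i => (x, i)) ∪ (Finset.univ.image fun i => (x - unitv d i, i))

/-- Bounded functions on `Ω`. -/
def IsBdd (d : ℕ) (f : EnvSp d → ℝ) : Prop := ∃ M, ∀ ω, |f ω| ≤ M

/-- Local functions: `f` depends only on the coordinates in some finite set `B` of edges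
and, viewed as a function of those coordinates, has compact support in `(0,∞)^B`. -/
def IsLocalFn (d : ℕ) (f : EnvSp d → ℝ) : Prop :=
  ∃ B : Finset (EdgeIx d),
    (∀ ω₁ ω₂ : EnvSp d, (∀ e ∈ B, ω₁.1 e = ω₂.1 e) → f ω₁ = f ω₂) ∧
    ∃ a b : ℝ, 0 < a ∧ ∀ ω : EnvSp d, (∃ e ∈ B, ω.1 e < a ∨ b < ω.1 e) → f ω = 0

/-- `ℓ_ω(f) = L`, i.e. the block averages of the translates of `f` converge to `L`. -/
def avgTo (d : ℕ) (ω : EnvSp d) (f : EnvSp d → ℝ) (L : ℝ) : Prop :=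
  Tendsto (fun n : ℕ => (∑ x ∈ box d (n : ℝ), f (shift d x ω)) / ((box d (n : ℝ)).card : ℝ))
    atTop (𝓝 L)

/-- `ω` is averaging: `ℓ_ω(f)` exists for every continuous local `f`. -/
def Averaging (d : ℕ) (ω : EnvSp d) : Prop :=
  ∀ f : EnvSp d → ℝ, Continuous f → IsLocalFn d f → ∃ L, avgTo d ω f L

/-- `ω` is tempered, i.e. `ω ∈ Ω'`. -/
def Tempered (d : ℕ) (ω : EnvSp d) : Prop :=
  Tendsto (fun ε : ℝ =>
      limsup (fun n : ℕ =>
        (∑ e ∈ edgesIn d (box d (n : ℝ)),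
            (if ε ≤ ω.1 e ∧ ω.1 e ≤ ε⁻¹ then (0:ℝ) else 1)) / (n : ℝ) ^ d) atTop)
    (𝓝[>] 0) (𝓝 0)

/-- `P` is the measure `ℙ_ω` associated with an averaging tempered `ω`:
the unique probability measure whose expectation of every bounded continuous function
is the corresponding block-average limit `ℓ_ω(f)`. -/
def IsEnvLaw (d : ℕ) (ω : EnvSp d) (P : Measure (EnvSp d)) : Prop :=
  IsProbabilityMeasure P ∧
    ∀ f : EnvSp d → ℝ, Continuous f → IsBdd d f → avgTo d ω f (∫ ω', f ω' ∂P)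

/-- Ergodicity of a measure on `Ω` with respect to the translations of `ℤ^d`. -/
def ErgodicEnv (d : ℕ) (P : Measure (EnvSp d)) : Prop :=
  ∀ A : Set (EnvSp d), MeasurableSet A → (∀ x : Vert d, shift d x ⁻¹' A = A) →
    P A = 0 ∨ P A = 1

/-- `ω ∈ Ω⋆`: tempered, averaging, and the associated measure `ℙ_ω` is ergodic. -/
def InOmegaStar (d : ℕ) (ω : EnvSp d) : Prop :=
  Tempered d ω ∧ Averaging d ω ∧
    ∀ P : Measure (EnvSp d), IsEnvLaw d ω P → ErgodicEnv d P

/-- `ω ∈ Ω_{p,q}`. -/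
def InOmegaPQ (d : ℕ) (p q : ℝ) (ω : EnvSp d) : Prop :=
  (∃ C : ℝ, ∀ n : ℕ, 1 ≤ n →
      (∑ e ∈ edgesIn d (box d (n : ℝ)), ω.1 e ^ p) / (n : ℝ) ^ d ≤ C) ∧
  (∃ C : ℝ, ∀ n : ℕ, 1 ≤ n →
      (∑ e ∈ edgesIn d (box d (n : ℝ)), ω.1 e ^ (-q)) / (n : ℝ) ^ d ≤ C)

/-- The path space of the discrete-time walk. -/
abbrev Path (d : ℕ) := ℕ → Vert d

/-- One-step transition probabilities `𝖯_ω(x,y) = c_ω(x,y)/π_ω(x)`. -/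
def transP (d : ℕ) (ω : EnvSp d) (x y : Vert d) : ℝ := cnd d ω x y / piOf d ω x

/-- `μ` is the law `P_ω^{x₀}` of the random walk among the conductances `ω`
started at `x₀`: a probability measure on the path space with the prescribed
finite-dimensional (cylinder) probabilities. -/
def IsWalkLaw (d : ℕ) (ω : EnvSp d) (x₀ : Vert d) (μ : Measure (Path d)) : Prop :=
  IsProbabilityMeasure μ ∧
    ∀ (n : ℕ) (γ : ℕ → Vert d),
      μ {w | ∀ k ≤ n, w k = γ k} =
        (if γ 0 = x₀ then 1 else 0) *
          ∏ k ∈ Finset.range n, ENNReal.ofReal (transP d ω (γ k) (γ (k+1)))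

/-- `n`-step transition probabilities of the discrete-time walk. -/
def stepP (d : ℕ) (ω : EnvSp d) : ℕ → Vert d → Vert d → ℝ
  | 0, x, y => if x = y then 1 else 0
  | n+1, x, y => ∑ z ∈ nbrs d x, transP d ω x z * stepP d ω n z y

/-- `P_ω^x(Y_t = y)` for the constant-speed continuous-time walk `Y_t = X_{N(t)}`,
where `N` is an independent rate-1 Poisson process. -/
def ctP (d : ℕ) (ω : EnvSp d) (t : ℝ) (x y : Vert d) : ℝ :=
  ∑' k : ℕ, Real.exp (-t) * t ^ k / (Nat.factorial k : ℝ) * stepP d ω k x y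

/-- The `ℓ¹`-norm of a vertex of `ℤ^d`. -/
def l1 (d : ℕ) (x : Vert d) : ℝ := ∑ i, |(x i : ℝ)|

/-- A vertex of `ℤ^d` regarded as a point of `ℝ^d`. -/
def ivert (d : ℕ) (x : Vert d) : Fin d → ℝ := fun i => (x i : ℝ)

/-- The linearly interpolated diffusively rescaled walk `B^{(n)}`. -/
def BnProc (d : ℕ) (n : ℕ) (w : Path d) (t : ℝ) : Fin d → ℝ :=
  (Real.sqrt n)⁻¹ •
    (ivert d (w ⌊t * n⌋₊) +
      (t * n - (⌊t * n⌋₊ : ℝ)) • (ivert d (w (⌊t * n⌋₊ + 1)) - ivert d (w ⌊t * n⌋₊)))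


/-- The measure `ℚ_ω` obtained from `ℙ_ω` by tilting with `π(0)`. -/
def Qmeas (d : ℕ) (P : Measure (EnvSp d)) : Measure (EnvSp d) :=
  P.withDensity fun ω' => ENNReal.ofReal (piOf d ω' 0 / ∫ ω'', piOf d ω'' 0 ∂P)

/-- The inner product `⟨f,g⟩_{L²(πμ)}`. -/
def innerP (d : ℕ) (P : Measure (EnvSp d)) (f g : EnvSp d → ℝ) : ℝ :=
  ∫ ω', f ω' * g ω' * piOf d ω' 0 ∂P

/-- The Dirichlet pairing `⟨h, (−L)h⟩_{L²(πμ)}`. -/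
def quadL (d : ℕ) (P : Measure (EnvSp d)) (h : EnvSp d → ℝ) : ℝ :=
  ∫ ω', (∑ z ∈ nbrs d 0, cnd d ω' 0 z * (h ω' - h (shift d z ω'))) * h ω' ∂P

/-- The inner product of `L²(ν)`. -/
def innerQ (d : ℕ) (ν : Measure (EnvSp d)) (f g : EnvSp d → ℝ) : ℝ :=
  ∫ ω', f ω' * g ω' ∂ν

/-- The Dirichlet pairing `⟨h, (−L)h⟩_{L²(ν)}`. -/
def quadQ (d : ℕ) (ν : Measure (EnvSp d)) (h : EnvSp d → ℝ) : ℝ :=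
  ∫ ω', ((piOf d ω' 0)⁻¹ *
      ∑ z ∈ nbrs d 0, cnd d ω' 0 z * (h ω' - h (shift d z ω'))) * h ω' ∂ν

/-- The set whose supremum is the variational characterization
`⟨f,(−L)⁻¹f⟩_{L²(ν)} = sup_h [2⟨h,f⟩ − ⟨h,(−L)h⟩]` (over bounded continuous `h`);
`⟨f,(−L)⁻¹f⟩_{L²(ν)} < ∞` means this set is bounded above. -/
def invPairSet (d : ℕ) (ν : Measure (EnvSp d)) (f : EnvSp d → ℝ) : Set ℝ :=
  {r | ∃ h : EnvSp d → ℝ, Continuous h ∧ IsBdd d h ∧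
        r = 2 * innerQ d ν h f - quadQ d ν h}

/-- The function `f(ω) = π_ω(0)⁻¹ ∇⋆(c v)(ω)` built from a vector field `v`. -/
def fDiv (d : ℕ) (v : EnvSp d → Fin d → ℝ) (ω : EnvSp d) : ℝ :=
  (piOf d ω 0)⁻¹ *
    ∑ i, (cnd d ω 0 (unitv d i) * v ω i -
          cnd d ω (-(unitv d i)) 0 * v (shift d (-(unitv d i)) ω) i)

/-- The inner product of `ℓ²(Λ,π_ω)`. -/
def innerF (d : ℕ) (ω : EnvSp d) (Λ : Finset (Vert d)) (f g : Vert d → ℝ) : ℝ :=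
  ∑ x ∈ Λ, f x * g x * piOf d ω x

/-- The pairing `⟨h, (−𝖫_ω)h⟩_{ℓ²(Λ,π_ω)}` for `h` vanishing outside `Λ`. -/
def quadF (d : ℕ) (ω : EnvSp d) (Λ : Finset (Vert d)) (h : Vert d → ℝ) : ℝ :=
  ∑ x ∈ Λ, (∑ z ∈ nbrs d x, cnd d ω x z * (h x - h z)) * h x

/-- `⟨f, (−𝖫_ω)⁻¹_Λ f⟩_{ℓ²(Λ,π_ω)}` via its variational characterization
`sup_h [2⟨h,f⟩ − ⟨h,(−𝖫_ω)h⟩]` over `h ∈ ℓ²(Λ,π_ω)`. -/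
def invPairF (d : ℕ) (ω : EnvSp d) (Λ : Finset (Vert d)) (f : Vert d → ℝ) : ℝ :=
  sSup {r | ∃ h : Vert d → ℝ, (∀ x ∉ Λ, h x = 0) ∧
      r = 2 * innerF d ω Λ h f - quadF d ω Λ h}

/-- The antisymmetric edge function `v∘τ(ω)`: the value assigned to the
edge `(x, x+e_i)` is `v_i(τ_x(ω))`. -/
def efield (d : ℕ) (v : EnvSp d → Fin d → ℝ) (ω : EnvSp d) : Vert d → Fin d → ℝ :=
  fun x i => v (shift d x ω) i

/-- The discrete gradient `∇h` of `h : ℤ^d → ℝ` as an edge function. -/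
def dgradE (d : ℕ) (h : Vert d → ℝ) : Vert d → Fin d → ℝ :=
  fun x i => h (x + unitv d i) - h x

/-- The inner product `⟨u,w⟩_{ℓ²(E(Λ), c_ω)}` of (antisymmetric) edge functions;
each unordered edge is counted once, which agrees with the paper's sum over
ordered edges carrying the factor ½. -/
def einner (d : ℕ) (ω : EnvSp d) (Λ : Finset (Vert d)) (u w : Vert d → Fin d → ℝ) : ℝ :=
  ∑ e ∈ edgesIn d Λ, u e.1 e.2 * w e.1 e.2 * ω.1 e

/-- The Dirichlet energy `𝓔_Λ^ω(v)`. -/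
def direnergy (d : ℕ) (ω : EnvSp d) (Λ : Finset (Vert d)) (v : EnvSp d → Fin d → ℝ) : ℝ :=
  sInf {r | ∃ h : Vert d → ℝ, (∀ x ∉ Λ, h x = 0) ∧
      r = einner d ω Λ (fun x i => efield d v ω x i - dgradE d h x i)
            (fun x i => efield d v ω x i - dgradE d h x i)}

/-- The gradient `∇h` of a function on `Ω`. -/
def gradOmega (d : ℕ) (h : EnvSp d → ℝ) : EnvSp d → Fin d → ℝ :=
  fun ω i => h (shift d (unitv d i) ω) - h ω

/-- The inner product `⟨u, c w⟩_{L²(P,ℝ^d)}`. -/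
def cinnerP (d : ℕ) (P : Measure (EnvSp d)) (u w : EnvSp d → Fin d → ℝ) : ℝ :=
  ∑ i, ∫ ω', cnd d ω' 0 (unitv d i) * u ω' i * w ω' i ∂P

/-- Bounded vector fields on `Ω`. -/
def IsBddV (d : ℕ) (v : EnvSp d → Fin d → ℝ) : Prop := ∃ M, ∀ ω i, |v ω i| ≤ M

/-- The space `𝒱 = (ℝ^d)^{ℤ^d}` of vector fields on `ℤ^d`. -/
abbrev VS (d : ℕ) := Vert d → Fin d → ℝ

/-- The empirical measures `μ_r^{ω,v}` built from the minimizers `h_r` of the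
finite-volume Dirichlet energies. -/
def muR (d : ℕ) (ω : EnvSp d) (hr : ℕ → Vert d → ℝ) (r : ℕ) :
    Measure (EnvSp d × VS d) :=
  (((box d ((r : ℝ) + Real.sqrt r)).card : ℝ≥0∞) *
      ((box d (Real.sqrt r)).card : ℝ≥0∞))⁻¹ •
    ∑ z ∈ box d (Real.sqrt r), ∑ x ∈ box d ((r : ℝ) + Real.sqrt r),
      Measure.dirac (shift d (x + z) ω, fun y => dgradE d (hr r) (x + z + y))

/-- The localized conductances `c_ω^R`. -/
def cR (d : ℕ) (ω : EnvSp d) (R : ℝ) (e : EdgeIx d) : ℝ :=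
  if e ∈ edgesIn d (box d (2 * R)) then ω.1 e else 1

/-- The localized measure `π_ω^R`. -/
def piRloc (d : ℕ) (ω : EnvSp d) (R : ℝ) (x : Vert d) : ℝ :=
  if x ∈ box d (2 * R) then piOf d ω x
  else if x ∈ box d (4 * R) then 1 + piOf d ω x else 1

/-- The localized Dirichlet form `D_ω^R(f,f)` (each unordered edge counted once). -/
def DR (d : ℕ) (ω : EnvSp d) (R : ℝ) (f : Vert d → ℝ) : ℝ≥0∞ :=
  ∑' e : EdgeIx d, ENNReal.ofReal (cR d ω R e * (f (e.1 + unitv d e.2) - f e.1) ^ 2)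

/-- The norm `‖f‖_{ℓ^s(μ)}`. -/
def lpN (d : ℕ) (μw : Vert d → ℝ) (s : ℝ) (f : Vert d → ℝ) : ℝ≥0∞ :=
  (∑' x : Vert d, ENNReal.ofReal (|f x| ^ s * μw x)) ^ (1 / s)

/-- The exponent `ε = 2(2/d − 1/p − 1/q)((d−2)/d + 1/q)⁻¹`. -/
def epsPQ (d : ℕ) (p q : ℝ) : ℝ :=
  2 * (2 / (d : ℝ) - 1 / p - 1 / q) / (((d : ℝ) - 2) / (d : ℝ) + 1 / q)

/-- Jump rates of the localized constant-speed chain `Y^R`: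
rate `c_ω^R(x,y)/π_ω^R(x)` from `x` to `y`. -/
def rateR (d : ℕ) (ω : EnvSp d) (R : ℝ) (x y : Vert d) : ℝ :=
  (∑ i, ((if y = x + unitv d i then cR d ω R (x, i) else 0) +
         (if x = y + unitv d i then cR d ω R (y, i) else 0))) / piRloc d ω R x

/-- The generator matrix of `Y^R`. -/
def qmatR (d : ℕ) (ω : EnvSp d) (R : ℝ) (x y : Vert d) : ℝ :=
  if x = y then -(∑ z ∈ nbrs d x, rateR d ω R x z) else rateR d ω R x y

/-- Iterates of the generator matrix of `Y^R`. -/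
def qiter (d : ℕ) (ω : EnvSp d) (R : ℝ) : ℕ → Vert d → Vert d → ℝ
  | 0, x, y => if x = y then 1 else 0
  | n+1, x, y => ∑ z ∈ insert x (nbrs d x), qmatR d ω R x z * qiter d ω R n z y

/-- The heat kernel `P_ω^x(Y_t^R = y) = (e^{tQ})(x,y)` of the localized chain `Y^R`. -/
def hkR (d : ℕ) (ω : EnvSp d) (R : ℝ) (t : ℝ) (x y : Vert d) : ℝ :=
  ∑' k : ℕ, t ^ k / (Nat.factorial k : ℝ) * qiter d ω R k x y

/-- A sum over the edges leaving `Λ` in positive directions, as a sum over `E(Λ)`. -/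
theorem sum_forward_edges {d : ℕ} (Λ : Finset (Vert d)) (h : Vert d → ℝ)
    (hh : ∀ x ∉ Λ, h x = 0) (F : EdgeIx d → ℝ) :
    ∑ x ∈ Λ, ∑ i, h x * F (x, i) = ∑ e ∈ edgesIn d Λ, h e.1 * F e := by
  rw [← Finset.sum_product' Λ Finset.univ (fun x i => h x * F (x, i))]
  refine Finset.sum_subset (fun e he => ?_) (fun e _ he => ?_)
  · simp only [Finset.mem_product, Finset.mem_univ, and_true] at he
    simp only [edgesIn, Finset.mem_biUnion, Finset.mem_union, Finset.mem_image,
      Finset.mem_univ, true_and]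
    exact ⟨e.1, he, Or.inl ⟨e.2, rfl⟩⟩
  · simp only [Finset.mem_product, Finset.mem_univ, and_true] at he
    rw [hh _ he, zero_mul]

/-- A sum over the edges entering `Λ` in positive directions, as a sum over `E(Λ)`. -/
theorem sum_backward_edges {d : ℕ} (Λ : Finset (Vert d)) (h : Vert d → ℝ)
    (hh : ∀ x ∉ Λ, h x = 0) (F : EdgeIx d → ℝ) :
    ∑ x ∈ Λ, ∑ i, h x * F (x - unitv d i, i) =
      ∑ e ∈ edgesIn d Λ, h (e.1 + unitv d e.2) * F e := by
  rw [← Finset.sum_product' Λ Finset.univ (fun x i => h x * F (x - unitv d i, i))]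
  let φ : EdgeIx d ↪ EdgeIx d :=
    ⟨fun e => (e.1 - unitv d e.2, e.2), fun e e' hee => by
      obtain ⟨x, i⟩ := e
      obtain ⟨y, j⟩ := e'
      simp only [Prod.mk.injEq] at hee
      obtain ⟨hxy, rfl⟩ := hee
      simpa using hxy⟩
  have hφ (p : EdgeIx d) : φ p = (p.1 - unitv d p.2, p.2) := rfl
  have hmap : ∑ p ∈ Λ ×ˢ (Finset.univ : Finset (Fin d)),
      h p.1 * F (p.1 - unitv d p.2, p.2) =
        ∑ e ∈ (Λ ×ˢ Finset.univ).map φ, h (e.1 + unitv d e.2) * F e := by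
    simp [Finset.sum_map, hφ]
  rw [hmap]
  refine Finset.sum_subset (fun e he => ?_) (fun e _ he => ?_)
  · obtain ⟨p, hp, rfl⟩ := Finset.mem_map.1 he
    simp only [Finset.mem_product, Finset.mem_univ, and_true] at hp
    simp only [edgesIn, Finset.mem_biUnion, Finset.mem_union, Finset.mem_image,
      Finset.mem_univ, true_and]
    exact ⟨p.1, hp, Or.inr ⟨p.2, rfl⟩⟩
  · rw [hh, zero_mul]
    intro hmem
    exact he (Finset.mem_map.2 ⟨(e.1 + unitv d e.2, e.2), by simpa using hmem, by simp [hφ]⟩)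

theorem unitv_injective (d : ℕ) : Function.Injective (unitv d) := by
  intro i j hij
  have h := congrFun hij i
  by_contra hne
  simp [unitv, hne] at h

theorem unitv_add_unitv_ne_zero {d : ℕ} (i j : Fin d) : unitv d i + unitv d j ≠ 0 := by
  intro h
  have h := congrFun h i
  simp only [Pi.add_apply, unitv, Pi.zero_apply, if_true] at h
  split_ifs at h <;> omega

theorem cnd_add_unitv {d : ℕ} (ω : EnvSp d) (x : Vert d) (i : Fin d) :
    cnd d ω x (x + unitv d i) = ω.1 (x, i) := by
  simp [cnd, add_assoc, (unitv_injective d).eq_iff, unitv_add_unitv_ne_zero]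

theorem sum_nbrs_cnd_mul {d : ℕ} (ω : EnvSp d) (x : Vert d) (G : Vert d → ℝ) :
    ∑ z ∈ nbrs d x, cnd d ω x z * G z =
      ∑ i, (ω.1 (x, i) * G (x + unitv d i) +
        ω.1 (x - unitv d i, i) * G (x - unitv d i)) := by
  simp only [cnd, Finset.sum_mul]
  rw [Finset.sum_comm]
  refine Finset.sum_congr rfl fun i _ => ?_
  simp only [add_mul, Finset.sum_add_distrib, ite_mul, zero_mul]
  congr 1
  · rw [Finset.sum_ite_eq' (nbrs d x) (x + unitv d i) fun z => ω.1 (x, i) * G z]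
    simp [nbrs]
  · simp only [← sub_eq_iff_eq_add]
    rw [Finset.sum_ite_eq (nbrs d x) (x - unitv d i) fun z => ω.1 (z, i) * G z]
    simp [nbrs]

theorem piOf_pos {d : ℕ} (hd : 1 ≤ d) (ω : EnvSp d) (x : Vert d) : 0 < piOf d ω x :=
  Finset.sum_pos (fun _ _ => add_pos (ω.2 _) (ω.2 _)) ⟨⟨0, hd⟩, Finset.mem_univ _⟩

theorem piOf_shift_zero {d : ℕ} (ω : EnvSp d) (x : Vert d) :
    piOf d (shift d x ω) 0 = piOf d ω x := by
  simp [piOf, shift, sub_eq_add_neg, add_comm]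

theorem shift_shift {d : ℕ} (ω : EnvSp d) (x y : Vert d) :
    shift d y (shift d x ω) = shift d (y + x) ω := by
  simp [shift, add_assoc]

/-- The divergence form of `f∘τ(ω)` with respect to the reversible weight. -/
theorem fDiv_shift_mul_piOf {d : ℕ} (hd : 1 ≤ d) (v : EnvSp d → Fin d → ℝ) (ω : EnvSp d)
    (x : Vert d) :
    fDiv d v (shift d x ω) * piOf d ω x =
      ∑ i, (ω.1 (x, i) * efield d v ω x i -
        ω.1 (x - unitv d i, i) * efield d v ω (x - unitv d i) i) := by
  have hfwd (i : Fin d) : cnd d (shift d x ω) 0 (unitv d i) = ω.1 (x, i) := by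
    simpa [shift] using cnd_add_unitv (shift d x ω) 0 i
  have hbwd (i : Fin d) :
      cnd d (shift d x ω) (-(unitv d i)) 0 = ω.1 (x - unitv d i, i) := by
    simpa [shift, neg_add_eq_sub] using cnd_add_unitv (shift d x ω) (-(unitv d i)) i
  have hpos := (piOf_pos hd ω x).ne'
  simp only [fDiv, piOf_shift_zero, shift_shift, hfwd, hbwd, efield, neg_add_eq_sub]
  field_simp

/-- Summation by parts: the divergence is minus the adjoint of the gradient. -/
theorem innerF_fDiv {d : ℕ} (hd : 1 ≤ d) (v : EnvSp d → Fin d → ℝ) (ω : EnvSp d)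
    (Λ : Finset (Vert d)) (h : Vert d → ℝ) (hh : ∀ x ∉ Λ, h x = 0) :
    innerF d ω Λ h (fun x => fDiv d v (shift d x ω)) =
      -einner d ω Λ (efield d v ω) (dgradE d h) := by
  have hF := sum_forward_edges Λ h hh fun e => ω.1 e * efield d v ω e.1 e.2
  have hB := sum_backward_edges Λ h hh fun e => ω.1 e * efield d v ω e.1 e.2
  calc innerF d ω Λ h (fun x => fDiv d v (shift d x ω))
      = ∑ x ∈ Λ, ∑ i, h x * (ω.1 (x, i) * efield d v ω x i) -
        ∑ x ∈ Λ, ∑ i, h x * (ω.1 (x - unitv d i, i) * efield d v ω (x - unitv d i) i) := by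
        simp only [innerF, mul_assoc, fDiv_shift_mul_piOf hd, Finset.mul_sum, mul_sub,
          Finset.sum_sub_distrib]
    _ = -einner d ω Λ (efield d v ω) (dgradE d h) := by
        rw [hF, hB, einner, ← Finset.sum_sub_distrib, ← Finset.sum_neg_distrib]
        refine Finset.sum_congr rfl fun e _ => ?_
        simp only [dgradE]
        ring

/-- The Dirichlet form as the squared norm of the gradient. -/
theorem quadF_eq_einner {d : ℕ} (ω : EnvSp d) (Λ : Finset (Vert d)) (h : Vert d → ℝ)
    (hh : ∀ x ∉ Λ, h x = 0) :
    quadF d ω Λ h = einner d ω Λ (dgradE d h) (dgradE d h) := by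
  have hF := sum_forward_edges Λ h hh fun e => -(ω.1 e * dgradE d h e.1 e.2)
  have hB := sum_backward_edges Λ h hh fun e => ω.1 e * dgradE d h e.1 e.2
  calc quadF d ω Λ h
      = ∑ x ∈ Λ, ∑ i, h x * -(ω.1 (x, i) * dgradE d h x i) +
        ∑ x ∈ Λ, ∑ i, h x * (ω.1 (x - unitv d i, i) * dgradE d h (x - unitv d i) i) := by
        simp only [quadF, ← Finset.sum_add_distrib]
        refine Finset.sum_congr rfl fun x _ => ?_
        rw [sum_nbrs_cnd_mul ω x fun z => h x - h z, Finset.sum_mul]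
        refine Finset.sum_congr rfl fun i _ => ?_
        simp only [dgradE, sub_add_cancel]
        ring
    _ = einner d ω Λ (dgradE d h) (dgradE d h) := by
        rw [hF, hB, einner, ← Finset.sum_add_distrib]
        refine Finset.sum_congr rfl fun e _ => ?_
        simp only [dgradE]
        ring

/-- Completing the square in the variational formula, with the test function negated. -/
theorem two_mul_innerF_neg_sub_quadF {d : ℕ} (hd : 1 ≤ d) (v : EnvSp d → Fin d → ℝ)
    (ω : EnvSp d) (Λ : Finset (Vert d)) (h : Vert d → ℝ) (hh : ∀ x ∉ Λ, h x = 0) :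
    2 * innerF d ω Λ (-h) (fun x => fDiv d v (shift d x ω)) - quadF d ω Λ (-h) =
      einner d ω Λ (efield d v ω) (efield d v ω) -
        einner d ω Λ (fun x i => efield d v ω x i - dgradE d h x i)
          (fun x i => efield d v ω x i - dgradE d h x i) := by
  have hh' : ∀ x ∉ Λ, (-h) x = 0 := fun x hx => by simp [hh x hx]
  rw [innerF_fDiv hd v ω Λ (-h) hh', quadF_eq_einner ω Λ (-h) hh']
  simp only [einner, Finset.mul_sum, ← Finset.sum_neg_distrib, ← Finset.sum_sub_distrib]
  refine Finset.sum_congr rfl fun e _ => ?_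
  simp only [dgradE, Pi.neg_apply]
  ring

theorem einner_self_nonneg {d : ℕ} (ω : EnvSp d) (Λ : Finset (Vert d))
    (u : Vert d → Fin d → ℝ) : 0 ≤ einner d ω Λ u u :=
  Finset.sum_nonneg fun e _ => mul_nonneg (mul_self_nonneg _) (ω.2 e).le

/-- Reflecting a set of reals bounded below turns its infimum into a supremum. -/
theorem csSup_image_const_sub {B : Set ℝ} (hne : B.Nonempty) (hbdd : BddBelow B) (a : ℝ) :
    sSup ((fun r => a - r) '' B) = a - sInf B := by
  refine IsLUB.csSup_eq ⟨?_, fun b hb => ?_⟩ (hne.image _)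
  · rintro _ ⟨r, hr, rfl⟩
    exact sub_le_sub_left (csInf_le hbdd hr) a
  · have : a - b ≤ sInf B := le_csInf hne fun r hr => by
      have : a - r ≤ b := hb ⟨r, hr, rfl⟩
      linarith
    linarith

/-- STATEMENT 14 (Lemma 5.5): finite-volume variational identity. -/
theorem statement14 (d : ℕ) (hd : 1 ≤ d) (v : EnvSp d → Fin d → ℝ)
    (hv : Continuous v) (hvb : IsBddV d v) (Λ : Finset (Vert d)) (ω : EnvSp d) :
    invPairF d ω Λ (fun x => fDiv d v (shift d x ω)) =
      einner d ω Λ (efield d v ω) (efield d v ω) - direnergy d ω Λ v := by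
  rw [direnergy, ← csSup_image_const_sub, invPairF]
  · congr 1
    ext r
    constructor
    · rintro ⟨h, hh, rfl⟩
      have hh' : ∀ x ∉ Λ, (-h) x = 0 := fun x hx => by simp [hh x hx]
      refine ⟨_, ⟨-h, hh', rfl⟩, ?_⟩
      simpa using (two_mul_innerF_neg_sub_quadF hd v ω Λ (-h) hh').symm
    · rintro ⟨_, ⟨h, hh, rfl⟩, rfl⟩
      exact ⟨-h, fun x hx => by simp [hh x hx],
        (two_mul_innerF_neg_sub_quadF hd v ω Λ h hh).symm⟩
  · exact ⟨_, 0, fun _ _ => rfl, rfl⟩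
  · refine ⟨0, ?_⟩
    rintro _ ⟨h, _, rfl⟩
    exact einner_self_nonneg ω Λ _


end DetCond
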